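/- Let p ∈ (−n, 1), ε ∈ (0, 1/3), and let μ be a Borel measure on S^{n-1} with dμ = f dH^{n-1} where τ_1 < f < τ_2 for constants τ_2 > τ_1 > 0. Let c > 0, t_0 > 0, and let (K_t)_{t ∈ [0,t_0)} be a family of convex bodies in ℝ^n with support functions h_t such that |h_t(u) − h_0(u)| ≤ c·t for all u ∈ S^{n-1} and t ∈ [0, t_0), and such that lim_{t→0^+} (h_t(u) − h_0(u))/t exists for H^{n-1}-almost all u ∈ S^{n-1}. Then the one-sided derivative lim_{t→0^+} (ξ(K_t) − ξ(K_0))/t exists. -/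

import Mathlib

open MeasureTheory Metric Set Filter
open scoped ENNReal RealInnerProductSpace NNReal

noncomputable section

abbrev Eu (n : ℕ) : Type := EuclideanSpace ℝ (Fin n)

def IsConvexBody {n : ℕ} (K : Set (Eu n)) : Prop :=
  Convex ℝ K ∧ IsCompact K ∧ (interior K).Nonempty

def suppFn {n : ℕ} (K : Set (Eu n)) (u : Eu n) : ℝ :=
  sSup ((fun x => ⟪x, u⟫) '' K)

def IsOuterNormal {n : ℕ} (K : Set (Eu n)) (x u : Eu n) : Prop :=
  ‖u‖ = 1 ∧ ∀ y ∈ K, ⟪y, u⟫ ≤ ⟪x, u⟫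

def gaussMap {n : ℕ} (K : Set (Eu n)) (x : Eu n) : Eu n :=
  open scoped Classical in
  if h : ∃ u, IsOuterNormal K x u then h.choose else 0

def lpSurf {n : ℕ} (p : ℝ) (K : Set (Eu n)) (ω : Set (Eu n)) : ℝ≥0∞ :=
  ∫⁻ x in {x ∈ frontier K | gaussMap K x ∈ ω},
    ENNReal.ofReal (⟪x, gaussMap K x⟫ ^ (1 - p)) ∂(μH[(n:ℝ) - 1])


/-- The function `φ` of Section 3: `φ(t) = t^p` for `p ∈ (0,1)`, `log t` for `p = 0`, and
`-t^p` for `p ∈ (-n,0)`. -/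
def phiFn (p : ℝ) (t : ℝ) : ℝ :=
  if 0 < p then t ^ p else if p = 0 then Real.log t else -(t ^ p)

/-- The modified energy density `φ_ε`: an increasing, strictly concave function on `(0,∞)`
with continuous negative second derivative that agrees with `φ` on `[3ε,∞)`, equals
`-t^{-q}` on `(0,ε]`, and satisfies `φ_ε(t) ≥ -t^{-q}` on `(0,1)`. -/
def IsPhiEps (p ε q : ℝ) (φ : ℝ → ℝ) : Prop :=
  StrictMonoOn φ (Set.Ioi 0) ∧
  StrictConcaveOn ℝ (Set.Ioi 0) φ ∧
  (∀ t ∈ Set.Ioi (0:ℝ), DifferentiableAt ℝ φ t ∧ DifferentiableAt ℝ (deriv φ) t ∧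
    deriv (deriv φ) t < 0) ∧
  ContinuousOn (deriv (deriv φ)) (Set.Ioi 0) ∧
  (∀ t : ℝ, 3 * ε ≤ t → φ t = phiFn p t) ∧
  (∀ t : ℝ, 0 < t → t ≤ ε → φ t = -(t ^ (-q))) ∧
  (∀ t ∈ Set.Ioo (0:ℝ) 1, -(t ^ (-q)) ≤ φ t)

/-- The energy `Φ_ε(K, ξ) = ∫_{S^{n-1}} φ_ε (h_K(u) - ⟨u, ξ⟩) dμ(u)`. -/
def PhiE {n : ℕ} (μ : Measure (Eu n)) (φ : ℝ → ℝ) (K : Set (Eu n)) (ξ : Eu n) : ℝ :=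
  ∫ u, φ (suppFn K u - ⟪u, ξ⟫) ∂μ

theorem continuous_suppFn {n : ℕ} {K : Set (Eu n)} (hK : IsCompact K) :
    Continuous (suppFn K) :=
  hK.continuous_sSup (f := fun u x => ⟪x, u⟫) (by fun_prop)

theorem inner_le_suppFn {n : ℕ} {K : Set (Eu n)} (hK : IsCompact K) {x : Eu n} (hx : x ∈ K)
    (u : Eu n) : ⟪x, u⟫ ≤ suppFn K u :=
  le_csSup (hK.image (by fun_prop)).bddAbove (mem_image_of_mem _ hx)

theorem suppFn_sub_inner_pos {n : ℕ} {K : Set (Eu n)} (hK : IsCompact K) {ξ : Eu n}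
    (hξ : ξ ∈ interior K) : ∃ δ > 0, ∀ u ∈ sphere (0 : Eu n) 1, δ ≤ suppFn K u - ⟪u, ξ⟫ := by
  obtain ⟨r, hr, hrK⟩ := Metric.isOpen_iff.1 isOpen_interior ξ hξ
  refine ⟨r / 2, by positivity, fun u hu => ?_⟩
  have hu1 : ‖u‖ = 1 := by simpa using hu
  have hmem : ξ + (r / 2) • u ∈ K := interior_subset (hrK (by
    simp [norm_smul, hu1, abs_of_pos hr]; linarith))
  have h := inner_le_suppFn hK hmem u
  rw [inner_add_left, inner_smul_left, real_inner_self_eq_norm_sq, hu1, real_inner_comm] at h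
  simp at h
  linarith

theorem lipschitzOnWith_normalize {E : Type*} [NormedAddCommGroup E] [NormedSpace ℝ E] :
    LipschitzOnWith 2 (fun x : E => ‖x‖⁻¹ • x) {x | 1 ≤ ‖x‖} := by
  refine LipschitzOnWith.of_dist_le_mul fun x (hx : 1 ≤ ‖x‖) y (hy : 1 ≤ ‖y‖) => ?_
  have hx0 : 0 < ‖x‖ := by linarith
  have hy0 : 0 < ‖y‖ := by linarith
  have h : ‖x‖⁻¹ • x - ‖y‖⁻¹ • y = ‖x‖⁻¹ • (x - y) + (‖x‖⁻¹ * (‖y‖ - ‖x‖) * ‖y‖⁻¹) • y := by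
    rw [show ‖x‖⁻¹ * (‖y‖ - ‖x‖) * ‖y‖⁻¹ = ‖x‖⁻¹ - ‖y‖⁻¹ by field_simp]
    module
  rw [dist_eq_norm, dist_eq_norm, h]
  have hinv : ‖x‖⁻¹ ≤ 1 := inv_le_one_of_one_le₀ hx
  calc _ ≤ ‖‖x‖⁻¹ • (x - y)‖ + ‖(‖x‖⁻¹ * (‖y‖ - ‖x‖) * ‖y‖⁻¹) • y‖ := norm_add_le _ _
    _ = ‖x‖⁻¹ * ‖x - y‖ + ‖x‖⁻¹ * |‖y‖ - ‖x‖| := by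
      rw [norm_smul, norm_smul, norm_mul, norm_mul, norm_inv, norm_inv, norm_norm, norm_norm,
        Real.norm_eq_abs]
      field_simp
    _ ≤ 1 * ‖x - y‖ + 1 * ‖x - y‖ := by
      gcongr
      rw [norm_sub_rev]
      exact abs_norm_sub_norm_le y x
    _ = _ := by push_cast; ring

theorem hausdorffMeasure_sphere_lt_top (m : ℕ) :
    μH[(m : ℝ)] (sphere (0 : Eu (m + 1)) 1) < ∞ := by
  let X : Fin (m + 1) → ℝ → (Fin m → ℝ) → Eu (m + 1) :=
    fun i s y => WithLp.toLp 2 (i.insertNth s y)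
  let N : Fin (m + 1) → ℝ → (Fin m → ℝ) → Eu (m + 1) := fun i s y => ‖X i s y‖⁻¹ • X i s y
  have hcover : sphere (0 : Eu (m + 1)) 1 ⊆
      ⋃ i, (N i 1 '' closedBall 0 1 ∪ N i (-1) '' closedBall 0 1) := by
    intro u hu
    have hu1 : ‖u‖ = 1 := by simpa using hu
    obtain ⟨i, hi⟩ := Finite.exists_max (fun i => |u i|)
    have hui : u i ≠ 0 := by
      intro h0
      have : u = 0 := by
        ext j
        simpa [h0] using hi j
      simp [this] at hu1
    have key : ∀ s : ℝ, s = u i / |u i| → u ∈ N i s '' closedBall 0 1 := by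
      intro s hs
      refine ⟨fun j => u (i.succAbove j) / |u i|, ?_, ?_⟩
      · rw [mem_closedBall_zero_iff, pi_norm_le_iff_of_nonneg zero_le_one]
        intro j
        rw [Real.norm_eq_abs, abs_div, abs_abs]
        exact div_le_one_of_le₀ (hi _) (abs_nonneg _)
      · have hX : X i s (fun j => u (i.succAbove j) / |u i|) = |u i|⁻¹ • u := by
          ext j
          refine Fin.succAboveCases i ?_ (fun j => ?_) j
          · simp [X, hs, div_eq_inv_mul]
          · simp [X, div_eq_inv_mul]
        simp only [N, hX, norm_smul, hu1, smul_smul]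
        simp [hui]
    refine mem_iUnion.2 ⟨i, ?_⟩
    rcases hui.lt_or_gt with h | h
    · exact Or.inr (key _ (by rw [abs_of_neg h]; field_simp))
    · exact Or.inl (key _ (by rw [abs_of_pos h]; field_simp))
  have hfin : ∀ i s, |s| = 1 → μH[(m : ℝ)] (N i s '' closedBall 0 1) < ∞ := by
    intro i s hs
    have hX : LipschitzWith _ (X i s) := (PiLp.lipschitzWith_toLp 2 (fun _ => ℝ)).comp
      (show LipschitzWith 1 (fun y : Fin m → ℝ => (i.insertNth s y : Fin (m + 1) → ℝ)) from
        LipschitzWith.of_dist_le_mul fun y z => by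
          rw [NNReal.coe_one, one_mul]
          refine (dist_pi_le_iff dist_nonneg).2 fun j => ?_
          refine Fin.succAboveCases i ?_ (fun j => ?_) j
          · simp
          · simpa using dist_le_pi_dist y z j)
    have hN : LipschitzOnWith _ (N i s) (closedBall 0 1) :=
      lipschitzOnWith_normalize.comp hX.lipschitzOnWith fun y _ => by
        have := PiLp.norm_apply_le (X i s y) i
        simpa [X, hs] using this
    refine (hN.hausdorffMeasure_image_le (Nat.cast_nonneg m)).trans_lt ?_
    refine ENNReal.mul_lt_top (ENNReal.rpow_lt_top_of_nonneg (Nat.cast_nonneg m) ENNReal.coe_ne_top) ?_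
    have h : (μH[(m : ℝ)] : Measure (Fin m → ℝ)) = volume := by
      simpa using hausdorffMeasure_pi_real (ι := Fin m)
    rw [h]
    exact measure_closedBall_lt_top
  refine (measure_mono hcover).trans_lt ?_
  refine (measure_iUnion_le _).trans_lt ?_
  rw [tsum_fintype]
  refine ENNReal.sum_lt_top.2 fun i _ => ?_
  exact (measure_union_le _ _).trans_lt
    (ENNReal.add_lt_top.2 ⟨hfin i 1 (by simp), hfin i (-1) (by simp)⟩)

theorem hausdorffMeasure_sphere_diff_hyperplane_pos {m : ℕ} {v : Eu (m + 1)} (hv : v ≠ 0) :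
    0 < μH[(m : ℝ)] (sphere (0 : Eu (m + 1)) 1 ∩ {u | ⟪u, v⟫ ≠ 0}) := by
  obtain ⟨i, hi⟩ : ∃ i, v i ≠ 0 := by
    by_contra! h
    exact hv (by ext j; simpa using h j)
  let π : Eu (m + 1) → (Fin m → ℝ) := fun u j => u (i.succAbove j)
  have hπ : LipschitzWith 1 π := LipschitzWith.of_dist_le_mul fun x y => by
    rw [NNReal.coe_one, one_mul]
    refine (dist_pi_le_iff dist_nonneg).2 fun j => ?_
    simpa [π, dist_eq_norm] using PiLp.norm_apply_le (x - y) (i.succAbove j)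
  have hsub : {y : Fin m → ℝ | ∑ j, y j ^ 2 < 1} ⊆
      π '' (sphere (0 : Eu (m + 1)) 1 ∩ {u | ⟪u, v⟫ ≠ 0}) := by
    intro y hy
    have hy' : 0 < 1 - ∑ j, y j ^ 2 := sub_pos.2 hy
    let U : ℝ → Eu (m + 1) := fun s => WithLp.toLp 2 (i.insertNth s y)
    have hU : ∀ s, s ^ 2 = 1 - ∑ j, y j ^ 2 → U s ∈ sphere (0 : Eu (m + 1)) 1 := by
      intro s hs
      rw [mem_sphere_zero_iff_norm, EuclideanSpace.norm_eq, Real.sqrt_eq_one,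
        Fin.sum_univ_succAbove _ i]
      simp [U, hs]
    have hin : ∀ s, ⟪U s, v⟫ = s * v i + ∑ j, y j * v (i.succAbove j) := by
      intro s
      simp [PiLp.inner_apply, Fin.sum_univ_succAbove _ i, U, mul_comm]
    have hπU : ∀ s, π (U s) = y := fun s => by ext j; simp [π, U]
    set r := Real.sqrt (1 - ∑ j, y j ^ 2) with hr
    have hr0 : 0 < r := Real.sqrt_pos.2 hy'
    have hr2 : r ^ 2 = 1 - ∑ j, y j ^ 2 := Real.sq_sqrt hy'.le
    by_cases h : ⟪U r, v⟫ = 0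
    · refine ⟨U (-r), ⟨hU _ (by rw [neg_sq, hr2]), fun h' => ?_⟩, hπU _⟩
      rw [hin] at h h'
      exact mul_ne_zero hr0.ne' hi (by linarith)
    · exact ⟨U r, ⟨hU _ hr2, h⟩, hπU _⟩
  have hvol : (μH[(m : ℝ)] : Measure (Fin m → ℝ)) = volume := by
    simpa using hausdorffMeasure_pi_real (ι := Fin m)
  have hopen : IsOpen {y : Fin m → ℝ | ∑ j, y j ^ 2 < 1} :=
    isOpen_lt (by fun_prop) continuous_const
  calc 0 < volume {y : Fin m → ℝ | ∑ j, y j ^ 2 < 1} := hopen.measure_pos _ ⟨0, by simp⟩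
    _ ≤ μH[(m : ℝ)] (π '' (sphere (0 : Eu (m + 1)) 1 ∩ {u | ⟪u, v⟫ ≠ 0})) := by
      rw [hvol]; exact measure_mono hsub
    _ ≤ _ := by simpa using hπ.hausdorffMeasure_image_le (Nat.cast_nonneg m) _

section SphereDensity

variable {m : ℕ} {f : Eu (m + 1) → ℝ}

theorem isFiniteMeasure_sphere_withDensity {τ : ℝ}
    (hf : ∀ u ∈ sphere (0 : Eu (m + 1)) 1, f u ≤ τ) :
    IsFiniteMeasure (((μH[(m : ℝ)]).restrict (sphere (0 : Eu (m + 1)) 1)).withDensity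
      fun u => ENNReal.ofReal (f u)) := by
  refine isFiniteMeasure_withDensity (ne_top_of_le_ne_top ?_
    (setLIntegral_mono measurable_const fun u hu => ENNReal.ofReal_le_ofReal (hf u hu)))
  rw [setLIntegral_const]
  exact ENNReal.mul_ne_top ENNReal.ofReal_ne_top (hausdorffMeasure_sphere_lt_top m).ne

theorem eq_zero_of_ae_inner_eq_zero_sphere_withDensity {τ : ℝ} (hτ : 0 < τ)
    (hf : ∀ u ∈ sphere (0 : Eu (m + 1)) 1, τ ≤ f u) {v : Eu (m + 1)}
    (hv : ∀ᵐ u ∂(((μH[(m : ℝ)]).restrict (sphere (0 : Eu (m + 1)) 1)).withDensity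
      fun u => ENNReal.ofReal (f u)), ⟪u, v⟫ = 0) : v = 0 := by
  by_contra hv0
  have hT : MeasurableSet {u : Eu (m + 1) | ⟪u, v⟫ ≠ 0} :=
    (isOpen_ne_fun (by fun_prop) continuous_const).measurableSet
  have hpos := hausdorffMeasure_sphere_diff_hyperplane_pos hv0
  have h0 : (((μH[(m : ℝ)]).restrict (sphere (0 : Eu (m + 1)) 1)).withDensity
      fun u => ENNReal.ofReal (f u)) {u | ⟪u, v⟫ ≠ 0} = 0 := ae_iff.1 hv
  rw [withDensity_apply _ hT, Measure.restrict_restrict hT, inter_comm] at h0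
  have hle : ENNReal.ofReal τ * μH[(m : ℝ)] (sphere (0 : Eu (m + 1)) 1 ∩ {u | ⟪u, v⟫ ≠ 0}) ≤ 0 := by
    rw [← h0, ← setLIntegral_const]
    exact setLIntegral_mono' (isClosed_sphere.measurableSet.inter hT)
      fun u hu => ENNReal.ofReal_le_ofReal (hf u hu.1)
  exact (ENNReal.mul_pos (ENNReal.ofReal_pos.2 hτ).ne' hpos.ne').not_ge hle

end SphereDensity

section SphereMeasure

variable {E : Type*} [NormedAddCommGroup E] [InnerProductSpace ℝ E] [FiniteDimensional ℝ E]
  [MeasurableSpace E] [BorelSpace E] {μ : Measure E} [IsFiniteMeasure μ]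

theorem integrable_comp_smul_of_pos (hS : ∀ᵐ u ∂μ, u ∈ sphere (0 : E) 1) {g : ℝ → ℝ}
    (hgm : Measurable g) (hgc : ContinuousOn g (Ioi 0)) {G : E → ℝ} (hG : Continuous G)
    (hpos : ∀ u ∈ sphere (0 : E) 1, 0 < G u) : Integrable (fun u => g (G u) • u) μ := by
  obtain ⟨C, hC⟩ := (isCompact_sphere (0 : E) 1).exists_bound_of_continuousOn
    (f := fun u => g (G u)) (hgc.comp hG.continuousOn hpos)
  refine Integrable.of_bound
    ((hgm.comp hG.measurable).aestronglyMeasurable.smul aestronglyMeasurable_id) C ?_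
  filter_upwards [hS] with u hu
  have hu1 : ‖u‖ = 1 := by simpa using hu
  simpa [norm_smul, hu1] using hC u hu

/-- The first-order condition at a maximizer of `ξ ↦ ∫ φ (h u - ⟪u, ξ⟫) dμ`. -/
theorem integral_deriv_comp_smul_eq_zero (hS : ∀ᵐ u ∂μ, u ∈ sphere (0 : E) 1) {φ : ℝ → ℝ}
    (hφ : ∀ t ∈ Ioi (0 : ℝ), DifferentiableAt ℝ φ t) (hφ' : ContinuousOn (deriv φ) (Ioi 0))
    {h : E → ℝ} (hh : Continuous h) {ξ : E} {δ : ℝ} (hδ : 0 < δ)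
    (hle : ∀ u ∈ sphere (0 : E) 1, δ ≤ h u - ⟪u, ξ⟫)
    (hmax : IsLocalMax (fun η => ∫ u, φ (h u - ⟪u, η⟫) ∂μ) ξ) :
    ∫ u, deriv φ (h u - ⟪u, ξ⟫) • u ∂μ = 0 := by
  have hint : Integrable (fun u => deriv φ (h u - ⟪u, ξ⟫) • u) μ :=
    integrable_comp_smul_of_pos hS (measurable_deriv φ) hφ' (by fun_prop)
      fun u hu => hδ.trans_le (hle u hu)
  have hφc : ContinuousOn φ (Ioi 0) := fun t ht => (hφ t ht).continuousAt.continuousWithinAt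
  refine ext_inner_left ℝ fun v => ?_
  rw [← integral_inner hint, inner_zero_right]
  obtain ⟨M, hM⟩ := (isCompact_sphere (0 : E) 1).bddAbove_image
    (f := fun u => h u - ⟪u, ξ⟫) (by fun_prop)
  have hM' : ∀ u ∈ sphere (0 : E) 1, h u - ⟪u, ξ⟫ ≤ M := fun u hu => hM (mem_image_of_mem _ hu)
  have hIcc : Icc (δ / 2) (M + δ) ⊆ Ioi 0 := fun x hx => (half_pos hδ).trans_le hx.1
  obtain ⟨C, hC⟩ := isCompact_Icc.exists_bound_of_continuousOn (hφ'.mono hIcc)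
  have hr : 0 < δ / (2 * (‖v‖ + 1)) := by positivity
  have hmem : ∀ u ∈ sphere (0 : E) 1, ∀ s ∈ ball (0 : ℝ) (δ / (2 * (‖v‖ + 1))),
      h u - ⟪u, ξ + s • v⟫ ∈ Icc (δ / 2) (M + δ) := by
    intro u hu s hs
    have hu1 : ‖u‖ = 1 := by simpa using hu
    have h1 : |⟪u, s • v⟫| ≤ δ / 2 := by
      calc |⟪u, s • v⟫| ≤ ‖u‖ * ‖s • v‖ := abs_real_inner_le_norm _ _
        _ = |s| * ‖v‖ := by rw [hu1, one_mul, norm_smul, Real.norm_eq_abs]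
        _ ≤ δ / (2 * (‖v‖ + 1)) * (‖v‖ + 1) := by
          have : |s| < δ / (2 * (‖v‖ + 1)) := by simpa using hs
          gcongr
          linarith
        _ = δ / 2 := by field_simp
    rw [abs_le] at h1
    rw [inner_add_right]
    constructor <;> linarith [hle u hu, hM' u hu]
  have hrestr : μ.restrict (sphere (0 : E) 1) = μ := Measure.restrict_eq_self_of_ae_mem hS
  have hcont : ∀ s ∈ ball (0 : ℝ) (δ / (2 * (‖v‖ + 1))),
      ContinuousOn (fun u => φ (h u - ⟪u, ξ + s • v⟫)) (sphere (0 : E) 1) := fun s hs =>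
    hφc.comp (by fun_prop) fun u hu => hIcc (hmem u hu s hs)
  have hball : ball (0 : ℝ) (δ / (2 * (‖v‖ + 1))) ∈ nhds (0 : ℝ) := ball_mem_nhds _ hr
  have hder := (hasDerivAt_integral_of_dominated_loc_of_deriv_le (μ := μ) (x₀ := (0 : ℝ))
    (F := fun s u => φ (h u - ⟪u, ξ + s • v⟫))
    (F' := fun s u => deriv φ (h u - ⟪u, ξ + s • v⟫) * (-⟪u, v⟫))
    (bound := fun _ => C * ‖v‖) hball ?_ ?_ ?_ ?_ (integrable_const _) ?_).2
  · have hmax0 : IsLocalMax (fun s : ℝ => ∫ u, φ (h u - ⟪u, ξ + s • v⟫) ∂μ) 0 := by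
      have ht : Tendsto (fun s : ℝ => ξ + s • v) (nhds 0) (nhds ξ) := by
        have : Continuous fun s : ℝ => ξ + s • v := by fun_prop
        simpa using this.tendsto 0
      have := ht.eventually hmax
      simpa [IsLocalMax, IsMaxFilter] using this
    have h0 := hmax0.hasDerivAt_eq_zero hder
    rw [← neg_eq_zero, ← integral_neg, ← h0]
    congr 1 with u
    simp [inner_smul_right, real_inner_comm]
  · filter_upwards [hball] with s hs
    rw [← hrestr]
    exact (hcont s hs).aestronglyMeasurable isClosed_sphere.measurableSet
  · rw [← hrestr]
    exact (hcont 0 (mem_ball_self hr)).integrableOn_compact (isCompact_sphere _ _)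
  · exact (((measurable_deriv φ).comp (by fun_prop)).mul (by fun_prop)).aestronglyMeasurable
  · filter_upwards [hS] with u hu s hs
    have hu1 : ‖u‖ = 1 := by simpa using hu
    rw [norm_mul, norm_neg]
    refine mul_le_mul (hC _ (hmem u hu s hs)) ?_ (norm_nonneg _)
      ((norm_nonneg _).trans (hC _ (hmem u hu s hs)))
    simpa [hu1] using norm_inner_le_norm (𝕜 := ℝ) u v
  · filter_upwards [hS] with u hu s hs
    refine (hφ _ (hIcc (hmem u hu s hs))).hasDerivAt.comp s ?_
    have h1 : HasDerivAt (fun s : ℝ => h u - (⟪u, ξ⟫ + s * ⟪u, v⟫)) (-(1 * ⟪u, v⟫)) s :=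
      (((hasDerivAt_id s).mul_const _).const_add _).const_sub _
    simpa [inner_add_right, inner_smul_right] using h1

theorem exists_pos_mul_sq_norm_le_integral_sq_inner (hS : ∀ᵐ u ∂μ, u ∈ sphere (0 : E) 1)
    (hnd : ∀ v : E, (∀ᵐ u ∂μ, ⟪u, v⟫ = 0) → v = 0) :
    ∃ c > 0, ∀ w : E, c * ‖w‖ ^ 2 ≤ ∫ u, ⟪u, w⟫ ^ 2 ∂μ := by
  have hbound : ∀ w : E, ∀ᵐ u ∂μ, ‖⟪u, w⟫ ^ 2‖ ≤ ‖w‖ ^ 2 := by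
    intro w
    filter_upwards [hS] with u hu
    have hu1 : ‖u‖ = 1 := by simpa using hu
    rw [norm_pow]
    gcongr
    simpa [hu1] using norm_inner_le_norm (𝕜 := ℝ) u w
  have hmeas : ∀ w : E, AEStronglyMeasurable (fun u => ⟪u, w⟫ ^ 2) μ := fun w =>
    Continuous.aestronglyMeasurable (by fun_prop)
  have hcont : ContinuousOn (fun w : E => ∫ u, ⟪u, w⟫ ^ 2 ∂μ) (sphere 0 1) := by
    refine continuousOn_of_dominated (bound := fun _ => 1) (fun w _ => hmeas w) (fun w hw => ?_)
      (integrable_const _) (ae_of_all _ fun u => by fun_prop)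
    have hw1 : ‖w‖ = 1 := by simpa using hw
    simpa [hw1] using hbound w
  have hpos : ∀ w : E, w ≠ 0 → 0 < ∫ u, ⟪u, w⟫ ^ 2 ∂μ := by
    intro w hw
    refine (integral_nonneg fun u => sq_nonneg _).lt_of_ne' fun h0 => hw (hnd w ?_)
    rw [integral_eq_zero_iff_of_nonneg (fun u => sq_nonneg _)
      (Integrable.of_bound (hmeas w) _ (hbound w))] at h0
    filter_upwards [h0] with u hu
    simpa using hu
  rcases (sphere (0 : E) 1).eq_empty_or_nonempty with he | hne
  · refine ⟨1, one_pos, fun w => ?_⟩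
    have hw : w = 0 := by
      by_contra hw
      have : ‖w‖⁻¹ • w ∈ sphere (0 : E) 1 := by simp [norm_smul, hw]
      simp [he] at this
    simp [hw]
  · obtain ⟨w₀, hw₀, hmin⟩ := (isCompact_sphere (0 : E) 1).exists_isMinOn hne hcont
    refine ⟨_, hpos w₀ (ne_zero_of_mem_unit_sphere ⟨w₀, hw₀⟩), fun w => ?_⟩
    rcases eq_or_ne w 0 with rfl | hw
    · simp
    have h1 : ‖w‖⁻¹ • w ∈ sphere (0 : E) 1 := by simp [norm_smul, hw]
    have h2 := hmin h1
    simp only [inner_smul_right, mul_pow, integral_const_mul, mem_ofPred_eq] at h2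
    have hw0 : 0 < ‖w‖ := norm_pos_iff.2 hw
    rw [inv_pow, ← div_eq_inv_mul, le_div_iff₀ (by positivity)] at h2
    exact h2

end SphereMeasure

theorem exists_lipschitz_strongMono_bounds_Icc {g : ℝ → ℝ} {a b : ℝ}
    (hg : ∀ x ∈ Icc a b, DifferentiableAt ℝ g x)
    (hneg : ∀ x ∈ Icc a b, deriv g x < 0) (hc : ContinuousOn (deriv g) (Icc a b)) :
    ∃ κ > 0, ∃ C ≥ 0, (∀ x ∈ Icc a b, |deriv g x| ≤ C) ∧ ∀ x ∈ Icc a b, ∀ y ∈ Icc a b,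
      |g y - g x| ≤ C * |y - x| ∧ κ * (y - x) ^ 2 ≤ (g x - g y) * (y - x) := by
  rcases (Icc a b).eq_empty_or_nonempty with he | hne
  · exact ⟨1, one_pos, 0, le_rfl, by simp [he], by simp [he]⟩
  obtain ⟨C, hC⟩ := isCompact_Icc.exists_bound_of_continuousOn hc
  obtain ⟨z, hz, hzmax⟩ := isCompact_Icc.exists_isMaxOn hne hc
  have hmono : ∀ x ∈ Icc a b, ∀ y ∈ Icc a b, x ≤ y → g y - g x ≤ deriv g z * (y - x) :=
    (convex_Icc a b).image_sub_le_mul_sub_of_deriv_le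
      (fun x hx => (hg x hx).continuousAt.continuousWithinAt)
      (fun x hx => (hg x (interior_subset hx)).differentiableWithinAt)
      (fun x hx => hzmax (interior_subset hx))
  refine ⟨-deriv g z, neg_pos.2 (hneg z hz), C, (norm_nonneg _).trans (hC z hz),
    fun x hx => hC x hx, fun x hx y hy => ⟨?_, ?_⟩⟩
  · exact (convex_Icc a b).norm_image_sub_le_of_norm_deriv_le hg hC hx hy
  · rcases le_total x y with h | h
    · nlinarith [hmono x hx y hy h]
    · nlinarith [hmono y hy x hx h]

section CriticalPoints

variable {E : Type*} [NormedAddCommGroup E] [InnerProductSpace ℝ E] [FiniteDimensional ℝ E]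
  [MeasurableSpace E] [BorelSpace E] {μ : Measure E} [IsFiniteMeasure μ]
  {g : ℝ → ℝ} {h : ℝ → E → ℝ} {ξ : ℝ → E} {c t₀ δ M : ℝ}

/-- Zeros of the strictly monotone vector fields `ξ ↦ ∫ g (h t u - ⟪u, ξ⟫) • u dμ` depend
continuously on `t` at `0⁺`. -/
theorem tendsto_critical_point (hS : ∀ᵐ u ∂μ, u ∈ sphere (0 : E) 1)
    (hnd : ∀ v : E, (∀ᵐ u ∂μ, ⟪u, v⟫ = 0) → v = 0)
    (hgm : Measurable g) (hgd : ∀ x ∈ Ioi (0 : ℝ), DifferentiableAt ℝ g x)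
    (hneg : ∀ x ∈ Ioi (0 : ℝ), deriv g x < 0) (hgc : ContinuousOn (deriv g) (Ioi 0))
    (hc : 0 < c) (ht₀ : 0 < t₀) (hδ : 0 < δ)
    (hcont : ∀ t ∈ Ico 0 t₀, Continuous (h t))
    (hpos : ∀ t ∈ Ico 0 t₀, ∀ u ∈ sphere (0 : E) 1, 0 < h t u - ⟪u, ξ t⟫)
    (hle : ∀ u ∈ sphere (0 : E) 1, δ ≤ h 0 u - ⟪u, ξ 0⟫)
    (hM : ∀ u ∈ sphere (0 : E) 1, h 0 u - ⟪u, ξ 0⟫ ≤ M)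
    (hcrit : ∀ t ∈ Ico 0 t₀, ∫ u, g (h t u - ⟪u, ξ t⟫) • u ∂μ = 0)
    (hlip : ∀ t ∈ Ico 0 t₀, ∀ u ∈ sphere (0 : E) 1, |h t u - h 0 u| ≤ c * t) :
    Tendsto ξ (nhdsWithin 0 (Ioi 0)) (nhds (ξ 0)) := by
  have hanti : AntitoneOn g (Ioi 0) := by
    refine antitoneOn_of_deriv_nonpos (convex_Ioi 0)
      (fun x hx => (hgd x hx).continuousAt.continuousWithinAt)
      (fun x hx => (hgd x (interior_subset hx)).differentiableWithinAt)
      (fun x hx => (hneg x (interior_subset hx)).le)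
  have hIcc : Icc (δ / 2) (M + δ) ⊆ Ioi 0 := fun x hx => (half_pos hδ).trans_le hx.1
  obtain ⟨κ, hκ, C, hC, -, hg⟩ := exists_lipschitz_strongMono_bounds_Icc
    (fun x hx => hgd x (hIcc hx)) (fun x hx => hneg x (hIcc hx)) (hgc.mono hIcc)
  obtain ⟨c₀, hc₀, hcoer⟩ := exists_pos_mul_sq_norm_le_integral_sq_inner hS hnd
  set C' : ℝ := C * c * μ.real univ / (κ * c₀) with hC'
  have hC'0 : 0 ≤ C' := by positivity
  have hr : 0 < δ / 4 := by positivity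
  suffices hfin : ∀ᶠ t in nhdsWithin (0 : ℝ) (Ioi 0), ‖ξ t - ξ 0‖ ≤ C' * t by
    rw [tendsto_iff_norm_sub_tendsto_zero]
    refine squeeze_zero' (Eventually.of_forall fun _ => norm_nonneg _) hfin ?_
    have : Continuous fun t : ℝ => C' * t := by fun_prop
    simpa using (this.tendsto 0).mono_left nhdsWithin_le_nhds
  have hsmall : ∀ C : ℝ, ∀ᶠ t in nhdsWithin (0 : ℝ) (Ioi 0), C * t < δ / 4 := fun C => by
    have : Continuous fun t : ℝ => C * t := by fun_prop
    exact ((this.tendsto 0).mono_left nhdsWithin_le_nhds).eventually_lt_const (by simpa using hr)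
  filter_upwards [Ioo_mem_nhdsGT ht₀, hsmall c, hsmall C'] with t ht htc htC'
  have htI : t ∈ Ico 0 t₀ := ⟨ht.1.le, ht.2⟩
  have h0I : (0 : ℝ) ∈ Ico 0 t₀ := ⟨le_rfl, ht₀⟩
  set w := ξ t - ξ 0 with hw
  set l : ℝ := δ / 4 / max (δ / 4) ‖w‖ with hl
  have hmax : 0 < max (δ / 4) ‖w‖ := hr.trans_le (le_max_left _ _)
  have hl0 : 0 < l := by positivity
  have hl1 : l ≤ 1 := div_le_one_of_le₀ (le_max_left _ _) hmax.le
  have hlw : l * ‖w‖ ≤ δ / 4 := by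
    rw [hl, div_mul_eq_mul_div, div_le_iff₀ hmax]
    exact mul_le_mul_of_nonneg_left (le_max_right _ _) hr.le
  have hint : ∀ s ∈ Ico 0 t₀, Integrable (fun u => g (h s u - ⟪u, ξ s⟫) • u) μ := fun s hs =>
    integrable_comp_smul_of_pos hS hgm (fun x hx => (hgd x hx).continuousAt.continuousWithinAt)
      ((hcont s hs).sub (by fun_prop)) (hpos s hs)
  have hpt : ∀ᵐ u ∂μ, κ * l * ⟪u, w⟫ ^ 2 - C * (c * t) * ‖w‖ ≤
      ⟪w, g (h t u - ⟪u, ξ t⟫) • u - g (h 0 u - ⟪u, ξ 0⟫) • u⟫ := by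
    filter_upwards [hS] with u hu
    have hu1 : ‖u‖ = 1 := by simpa using hu
    rw [← sub_smul, inner_smul_right, real_inner_comm u w]
    set s := ⟪u, w⟫ with hs
    have hsw : |s| ≤ ‖w‖ := by simpa [hu1] using abs_real_inner_le_norm u w
    have hls : |l * s| ≤ δ / 4 := by
      rw [abs_mul, abs_of_pos hl0]
      exact (mul_le_mul_of_nonneg_left hsw hl0.le).trans hlw
    have hat : h t u - ⟪u, ξ t⟫ = h t u - ⟪u, ξ 0⟫ - s := by
      rw [hs, hw, inner_sub_right]; ring
    have hposu := hpos t htI u hu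
    have hlipu := hlip t htI u hu
    have h1 := hle u hu
    have h2 := hM u hu
    rw [hat] at hposu ⊢
    set a := h t u - ⟪u, ξ 0⟫ with ha
    set b := h 0 u - ⟪u, ξ 0⟫ with hb
    have hab : |a - b| ≤ c * t := by rw [ha, hb]; simpa using hlipu
    have hab' := abs_le.1 hab
    have hls' := abs_le.1 hls
    have haI : a ∈ Icc (δ / 2) (M + δ) := by constructor <;> linarith
    have hbI : b ∈ Icc (δ / 2) (M + δ) := by constructor <;> linarith
    have hasI : a - l * s ∈ Icc (δ / 2) (M + δ) := by constructor <;> linarith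
    have hstrong : κ * l * s ^ 2 ≤ (g (a - l * s) - g a) * s := by
      have h3 := (hg _ hasI _ haI).2
      rw [sub_sub_cancel] at h3
      refine le_of_mul_le_mul_left (a := l) ?_ hl0
      linarith
    have hmon : (g (a - l * s) - g a) * s ≤ (g (a - s) - g a) * s := by
      rcases le_total 0 s with hs0 | hs0
      · have : g (a - l * s) ≤ g (a - s) := hanti hposu (hIcc hasI) (by nlinarith)
        exact mul_le_mul_of_nonneg_right (by linarith) hs0
      · have : g (a - s) ≤ g (a - l * s) := hanti (hIcc hasI) hposu (by nlinarith)
        exact mul_le_mul_of_nonpos_right (by linarith) hs0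
    have herr : |(g a - g b) * s| ≤ C * (c * t) * ‖w‖ := by
      rw [abs_mul]
      have := (hg b hbI a haI).1
      have h5 : |g a - g b| ≤ C * (c * t) :=
        this.trans (mul_le_mul_of_nonneg_left hab hC)
      exact mul_le_mul h5 hsw (abs_nonneg _) ((abs_nonneg _).trans h5)
    have := (abs_le.1 herr).1
    nlinarith
  have hsub := (hint t htI).sub (hint 0 h0I)
  have hsq : Integrable (fun u => ⟪u, w⟫ ^ 2) μ := by
    refine Integrable.of_bound (Continuous.aestronglyMeasurable (by fun_prop)) (‖w‖ ^ 2) ?_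
    filter_upwards [hS] with u hu
    have hu1 : ‖u‖ = 1 := by simpa using hu
    rw [norm_pow]
    gcongr
    simpa [hu1] using norm_inner_le_norm (𝕜 := ℝ) u w
  have hmono := integral_mono_ae ((hsq.const_mul (κ * l)).sub (integrable_const _))
    (hsub.const_inner w) hpt
  have hzero : ∫ u, ⟪w, g (h t u - ⟪u, ξ t⟫) • u - g (h 0 u - ⟪u, ξ 0⟫) • u⟫ ∂μ = 0 := by
    refine (integral_inner hsub w).trans ?_
    have := integral_sub (hint t htI) (hint 0 h0I)
    rw [hcrit t htI, hcrit 0 h0I, sub_zero] at this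
    simp [this]
  have hkey : κ * l * (c₀ * ‖w‖ ^ 2) ≤ C * (c * t) * ‖w‖ * μ.real univ := by
    have h6 : κ * l * (∫ u, ⟪u, w⟫ ^ 2 ∂μ) - C * (c * t) * ‖w‖ * μ.real univ ≤ 0 := by
      refine (le_of_eq ?_).trans (hmono.trans_eq hzero)
      refine Eq.trans ?_ (integral_sub (hsq.const_mul (κ * l)) (integrable_const _)).symm
      rw [integral_const_mul, integral_const, smul_eq_mul]
      ring
    have := mul_le_mul_of_nonneg_left (hcoer w) (mul_pos hκ hl0).le
    linarith
  rcases eq_or_ne w 0 with hw0 | hw0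
  · rw [hw0, norm_zero]
    exact mul_nonneg hC'0 ht.1.le
  have hw0' : 0 < ‖w‖ := norm_pos_iff.2 hw0
  have hlC : l * ‖w‖ ≤ C' * t := by
    rw [hC', div_mul_eq_mul_div (C * c * μ.real univ), le_div_iff₀ (by positivity)]
    refine le_of_mul_le_mul_right (a := ‖w‖) ?_ hw0'
    nlinarith
  have hwr : ‖w‖ < δ / 4 := by
    by_contra! hcon
    rw [hl, max_eq_right hcon, div_mul_cancel₀ _ hw0'.ne'] at hlC
    linarith
  rwa [hl, max_eq_left hwr.le, div_self hr.ne', one_mul] at hlC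

theorem tendsto_slope_critical_point (hS : ∀ᵐ u ∂μ, u ∈ sphere (0 : E) 1)
    (hnd : ∀ v : E, (∀ᵐ u ∂μ, ⟪u, v⟫ = 0) → v = 0)
    (hgm : Measurable g) (hgd : ∀ x ∈ Ioi (0 : ℝ), DifferentiableAt ℝ g x)
    (hneg : ∀ x ∈ Ioi (0 : ℝ), deriv g x < 0) (hgc : ContinuousOn (deriv g) (Ioi 0))
    (hc : 0 < c) (ht₀ : 0 < t₀) (hδ : 0 < δ)
    (hcont : ∀ t ∈ Ico 0 t₀, Continuous (h t))
    (hpos : ∀ t ∈ Ico 0 t₀, ∀ u ∈ sphere (0 : E) 1, 0 < h t u - ⟪u, ξ t⟫)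
    (hle : ∀ u ∈ sphere (0 : E) 1, δ ≤ h 0 u - ⟪u, ξ 0⟫)
    (hM : ∀ u ∈ sphere (0 : E) 1, h 0 u - ⟪u, ξ 0⟫ ≤ M)
    (hcrit : ∀ t ∈ Ico 0 t₀, ∫ u, g (h t u - ⟪u, ξ t⟫) • u ∂μ = 0)
    (hlip : ∀ t ∈ Ico 0 t₀, ∀ u ∈ sphere (0 : E) 1, |h t u - h 0 u| ≤ c * t)
    (hae : ∀ᵐ u ∂μ, ∃ l : ℝ, Tendsto (fun t => (h t u - h 0 u) / t)
      (nhdsWithin 0 (Ioi 0)) (nhds l)) :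
    ∃ L : E, Tendsto (fun t : ℝ => t⁻¹ • (ξ t - ξ 0)) (nhdsWithin 0 (Ioi 0)) (nhds L) := by
  have hξ := tendsto_critical_point hS hnd hgm hgd hneg hgc hc ht₀ hδ hcont hpos hle hM hcrit hlip
  have hIcc : Icc (δ / 2) (M + δ) ⊆ Ioi 0 := fun x hx => (half_pos hδ).trans_le hx.1
  obtain ⟨κ, hκ, C, hC, hdC, hg⟩ := exists_lipschitz_strongMono_bounds_Icc
    (fun x hx => hgd x (hIcc hx)) (fun x hx => hneg x (hIcc hx)) (hgc.mono hIcc)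
  let l : E → ℝ := fun u => limUnder (nhdsWithin 0 (Ioi 0)) fun t => (h t u - h 0 u) / t
  have hl : ∀ᵐ u ∂μ, Tendsto (fun t => (h t u - h 0 u) / t) (nhdsWithin 0 (Ioi 0))
      (nhds (l u)) := hae.mono fun u hu => tendsto_nhds_limUnder hu
  have h0I : (0 : ℝ) ∈ Ico 0 t₀ := ⟨le_rfl, ht₀⟩
  let G : ℝ → E → ℝ := fun t u => h t u - ⟪u, ξ t⟫
  let a : ℝ → E → ℝ := fun t u => dslope g (G 0 u) (G t u)
  let P : E → E →L[ℝ] E := fun u => (innerSL ℝ u).smulRight u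
  let A : ℝ → E →L[ℝ] E := fun t => ∫ u, a t u • P u ∂μ
  let A₀ : E →L[ℝ] E := ∫ u, deriv g (G 0 u) • P u ∂μ
  let b : ℝ → E := fun t => ∫ u, (a t u * ((h t u - h 0 u) / t)) • u ∂μ
  have hGc : ∀ t ∈ Ico 0 t₀, Continuous (G t) := fun t ht => (hcont t ht).sub (by fun_prop)
  have hPc : Continuous P := by
    have : P = fun u => ContinuousLinearMap.smulRightL ℝ E E (innerSL ℝ u) u := rfl
    rw [this]
    fun_prop
  have hPn : ∀ u ∈ sphere (0 : E) 1, ‖P u‖ = 1 := by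
    intro u hu
    have hu1 : ‖u‖ = 1 := by simpa using hu
    simp [P, hu1]
  have hG0I : ∀ u ∈ sphere (0 : E) 1, G 0 u ∈ Icc (δ / 2) (M + δ) := fun u hu => by
    have h1 := hle u hu
    have h2 := hM u hu
    constructor <;> simp only [G] <;> linarith
  -- near `0⁺`, the values of `G t` stay in a fixed compact interval
  have hdiff : ∀ t ∈ Ico 0 t₀, ∀ u ∈ sphere (0 : E) 1,
      |G t u - G 0 u| ≤ c * t + ‖ξ t - ξ 0‖ := by
    intro t ht u hu
    have hu1 : ‖u‖ = 1 := by simpa using hu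
    have h1 : G t u - G 0 u = (h t u - h 0 u) - ⟪u, ξ t - ξ 0⟫ := by
      simp only [G, inner_sub_right]; ring
    have h2 : |⟪u, ξ t - ξ 0⟫| ≤ ‖ξ t - ξ 0‖ := by
      simpa [hu1] using abs_real_inner_le_norm u (ξ t - ξ 0)
    rw [h1]
    exact (abs_sub _ _).trans (add_le_add (hlip t ht u hu) h2)
  have hlim0 : Tendsto (fun t => c * t + ‖ξ t - ξ 0‖) (nhdsWithin 0 (Ioi 0)) (nhds 0) := by
    have h1 : Tendsto (fun t : ℝ => c * t) (nhdsWithin 0 (Ioi 0)) (nhds 0) := by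
      have : Continuous fun t : ℝ => c * t := by fun_prop
      simpa using (this.tendsto 0).mono_left nhdsWithin_le_nhds
    simpa using h1.add (tendsto_iff_norm_sub_tendsto_zero.1 hξ)
  have hGlim : ∀ u ∈ sphere (0 : E) 1,
      Tendsto (fun t => G t u) (nhdsWithin 0 (Ioi 0)) (nhds (G 0 u)) := by
    intro u hu
    rw [tendsto_iff_norm_sub_tendsto_zero]
    refine squeeze_zero' (Eventually.of_forall fun _ => norm_nonneg _) ?_ hlim0
    filter_upwards [Ioo_mem_nhdsGT ht₀] with t ht
    exact hdiff t ⟨ht.1.le, ht.2⟩ u hu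
  have hGI : ∀ᶠ t in nhdsWithin (0 : ℝ) (Ioi 0), t ∈ Ioo 0 t₀ ∧
      ∀ u ∈ sphere (0 : E) 1, G t u ∈ Icc (δ / 2) (M + δ) := by
    filter_upwards [Ioo_mem_nhdsGT ht₀, hlim0.eventually_lt_const (half_pos hδ)] with t ht hsm
    refine ⟨ht, fun u hu => ?_⟩
    have h1 := hle u hu
    have h2 := hM u hu
    have h3 := abs_le.1 ((hdiff t ⟨ht.1.le, ht.2⟩ u hu).trans hsm.le)
    simp only [G] at h3 ⊢
    constructor <;> linarith
  have haC : ∀ᶠ t in nhdsWithin (0 : ℝ) (Ioi 0), ∀ u ∈ sphere (0 : E) 1, |a t u| ≤ C := by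
    filter_upwards [hGI] with t ht u hu
    rcases eq_or_ne (G t u) (G 0 u) with he | hne
    · simp only [a, he, dslope_same]
      exact hdC _ (hG0I u hu)
    · simp only [a]
      rw [dslope_of_ne _ hne, slope_def_field, abs_div,
        div_le_iff₀ (abs_pos.2 (sub_ne_zero.2 hne))]
      exact (hg _ (hG0I u hu) _ (ht.2 u hu)).1
  have hameas : ∀ t ∈ Ico 0 t₀, Measurable (a t) := by
    intro t ht
    have hmt := (hGc t ht).measurable
    have hm0 := (hGc 0 h0I).measurable
    have : a t = fun u => if G t u = G 0 u then deriv g (G 0 u)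
        else (g (G t u) - g (G 0 u)) / (G t u - G 0 u) := by
      ext u
      split_ifs with he
      · simp only [a, he, dslope_same]
      · simp only [a]
        rw [dslope_of_ne _ he, slope_def_field]
    rw [this]
    exact Measurable.ite (measurableSet_eq_fun hmt hm0) ((measurable_deriv g).comp hm0)
      (((hgm.comp hmt).sub (hgm.comp hm0)).div (hmt.sub hm0))
  have halim : ∀ u ∈ sphere (0 : E) 1,
      Tendsto (fun t => a t u) (nhdsWithin 0 (Ioi 0)) (nhds (deriv g (G 0 u))) := by
    intro u hu
    have h1 := continuousAt_dslope_same.2 (hgd _ (hIcc (hG0I u hu)))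
    have h2 := h1.tendsto.comp (hGlim u hu)
    rwa [dslope_same] at h2
  have haint : ∀ᶠ t in nhdsWithin (0 : ℝ) (Ioi 0), Integrable (fun u => a t u • P u) μ := by
    filter_upwards [hGI, haC] with t ht htC
    refine Integrable.of_bound ((hameas t ⟨ht.1.1.le, ht.1.2⟩).aestronglyMeasurable.smul
      hPc.aestronglyMeasurable) C ?_
    filter_upwards [hS] with u hu
    rw [norm_smul, hPn u hu, mul_one]
    exact htC u hu
  have hAlim : Tendsto A (nhdsWithin 0 (Ioi 0)) (nhds A₀) := by
    refine tendsto_integral_filter_of_dominated_convergence (fun _ => C)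
      (haint.mono fun t ht => ht.aestronglyMeasurable) ?_ (integrable_const _) ?_
    · filter_upwards [haC] with t htC
      filter_upwards [hS] with u hu
      rw [norm_smul, hPn u hu, mul_one]
      exact htC u hu
    · filter_upwards [hS] with u hu
      exact (halim u hu).smul_const _
  have hblim : Tendsto b (nhdsWithin 0 (Ioi 0))
      (nhds (∫ u, (deriv g (G 0 u) * l u) • u ∂μ)) := by
    refine tendsto_integral_filter_of_dominated_convergence (fun _ => C * c) ?_ ?_
      (integrable_const _) ?_
    · filter_upwards [hGI] with t ht
      have htI : t ∈ Ico 0 t₀ := ⟨ht.1.1.le, ht.1.2⟩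
      exact (((hameas t htI).mul (((hcont t htI).sub (hcont 0 h0I)).div_const
        t).measurable).aestronglyMeasurable).smul aestronglyMeasurable_id
    · filter_upwards [hGI, haC] with t ht htC
      filter_upwards [hS] with u hu
      have hu1 : ‖u‖ = 1 := by simpa using hu
      rw [norm_smul, hu1, mul_one, norm_mul]
      refine mul_le_mul (htC u hu) ?_ (norm_nonneg _) hC
      rw [Real.norm_eq_abs, abs_div, abs_of_pos ht.1.1, div_le_iff₀ ht.1.1]
      exact hlip t ⟨ht.1.1.le, ht.1.2⟩ u hu
    · filter_upwards [hS, hl] with u hu hlu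
      exact ((halim u hu).mul hlu).smul_const _
  have hA₀int : Integrable (fun u => deriv g (G 0 u) • P u) μ := by
    refine Integrable.of_bound (((measurable_deriv g).comp
      (hGc 0 h0I).measurable).aestronglyMeasurable.smul hPc.aestronglyMeasurable) C ?_
    filter_upwards [hS] with u hu
    rw [norm_smul, hPn u hu, mul_one]
    exact hdC _ (hG0I u hu)
  have hA₀unit : IsUnit A₀ := by
    have hinj : Function.Injective A₀ := by
      refine (injective_iff_map_eq_zero A₀).2 fun v hv => hnd v ?_
      have h1 : ∫ u, -(deriv g (G 0 u) * ⟪u, v⟫ ^ 2) ∂μ = 0 := by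
        have h2 : ⟪v, A₀ v⟫ = ∫ u, deriv g (G 0 u) * ⟪u, v⟫ ^ 2 ∂μ := by
          simp only [A₀]
          rw [ContinuousLinearMap.integral_apply hA₀int,
            ← integral_inner (hA₀int.apply_continuousLinearMap v)]
          congr 1 with u
          simp [P, inner_smul_right, real_inner_comm u v, sq]
        rw [integral_neg, ← h2, hv, inner_zero_right, neg_zero]
      have hint : Integrable (fun u => -(deriv g (G 0 u) * ⟪u, v⟫ ^ 2)) μ := by
        refine (((hA₀int.apply_continuousLinearMap v).const_inner v).neg).congr
          (ae_of_all _ fun u => ?_)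
        simp [P, inner_smul_right, real_inner_comm u v, sq]
      have hnn : 0 ≤ᵐ[μ] fun u => -(deriv g (G 0 u) * ⟪u, v⟫ ^ 2) := by
        filter_upwards [hS] with u hu
        have := hneg _ (hIcc (hG0I u hu))
        simp only [Pi.zero_apply]
        nlinarith [sq_nonneg ⟪u, v⟫]
      filter_upwards [(integral_eq_zero_iff_of_nonneg_ae hnn hint).1 h1, hS] with u hu huS
      have := hneg _ (hIcc (hG0I u huS))
      simpa [this.ne] using hu
    exact ContinuousLinearMap.isUnit_iff_bijective.2
      ⟨hinj, (LinearMap.injective_iff_surjective (f := A₀.toLinearMap)).1 hinj⟩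
  have heq : ∀ᶠ t in nhdsWithin (0 : ℝ) (Ioi 0), A t (t⁻¹ • (ξ t - ξ 0)) = b t := by
    filter_upwards [hGI, haint] with t ht hti
    have htI : t ∈ Ico 0 t₀ := ⟨ht.1.1.le, ht.1.2⟩
    have hint : ∀ s ∈ Ico 0 t₀, Integrable (fun u => g (G s u) • u) μ := fun s hs =>
      integrable_comp_smul_of_pos hS hgm
        (fun x hx => (hgd x hx).continuousAt.continuousWithinAt) (hGc s hs) (hpos s hs)
    have h1 := integral_sub (hint t htI) (hint 0 h0I)
    rw [show ∫ u, g (G t u) • u ∂μ = 0 from hcrit t htI,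
      show ∫ u, g (G 0 u) • u ∂μ = 0 from hcrit 0 h0I, sub_zero] at h1
    have h1' : ∫ u, t⁻¹ • (g (G t u) • u - g (G 0 u) • u) ∂μ = 0 := by
      rw [integral_smul, h1, smul_zero]
    have hint' : Integrable (fun u => t⁻¹ • (g (G t u) • u - g (G 0 u) • u)) μ :=
      ((hint t htI).sub (hint 0 h0I)).smul t⁻¹
    simp only [A, b]
    rw [ContinuousLinearMap.integral_apply hti, ← add_zero (∫ u, (a t u • P u) _ ∂μ),
      ← h1', ← integral_add (hti.apply_continuousLinearMap _) hint']
    congr 1 with u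
    have h2 : g (G t u) - g (G 0 u) = (G t u - G 0 u) * a t u :=
      (sub_smul_dslope g (G 0 u) (G t u)).symm
    have h3 : G t u - G 0 u = (h t u - h 0 u) - ⟪u, ξ t - ξ 0⟫ := by
      simp only [G, inner_sub_right]; ring
    rw [← sub_smul, h2, h3]
    simp only [P, smul_apply, ContinuousLinearMap.smulRight_apply,
      innerSL_apply_apply, inner_smul_right]
    module
  obtain ⟨A₀u, hA₀u⟩ := hA₀unit
  have hev : ∀ᶠ t in nhdsWithin (0 : ℝ) (Ioi 0), IsUnit (A t) :=
    hAlim.eventually (hA₀u ▸ A₀u.nhds)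
  have hinv : Tendsto (fun t => Ring.inverse (A t)) (nhdsWithin 0 (Ioi 0))
      (nhds (Ring.inverse A₀)) := by
    have := NormedRing.inverse_continuousAt A₀u
    rw [hA₀u] at this
    exact this.tendsto.comp hAlim
  refine ⟨_, ((isBoundedBilinearMap_apply.continuous.tendsto (_, _)).comp
    (hinv.prodMk_nhds hblim)).congr' ?_⟩
  filter_upwards [heq, hev] with t ht hu
  simp only [Function.comp_apply]
  rw [← ht, ← mul_apply_eq_comp, Ring.inverse_mul_cancel _ hu,
    one_apply_eq_self]

end CriticalPoints

/-- Lemma 3.6: if a family `(K_t)_{t ∈ [0,t₀)}` of convex bodies satisfies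
`|h_t(u) - h_0(u)| ≤ c t` for all `u ∈ S^{n-1}` and `lim_{t→0⁺} (h_t(u) - h_0(u))/t` exists
for `H^{n-1}`-a.e. `u`, then the one-sided derivative `lim_{t→0⁺} (ξ(K_t) - ξ(K_0))/t`
exists. -/
theorem optimal_center_differentiable
    (n : ℕ) (p ε q τ₁ τ₂ : ℝ)
    (hp : -(n : ℝ) < p ∧ p < 1) (hε : ε ∈ Set.Ioo (0:ℝ) (1/3))
    (hq : q = max |p| ((n : ℝ) - 1))
    (φ : ℝ → ℝ) (hφ : IsPhiEps p ε q φ)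
    (hτ : 0 < τ₁ ∧ τ₁ < τ₂)
    (f : Eu n → ℝ) (hf : ∀ u ∈ sphere (0 : Eu n) 1, τ₁ < f u ∧ f u < τ₂)
    (μ : Measure (Eu n))
    (hμ : μ = ((μH[(n:ℝ) - 1]).restrict (sphere (0 : Eu n) 1)).withDensity
      (fun u => ENNReal.ofReal (f u)))
    (ξfun : Set (Eu n) → Eu n)
    (hξfun : ∀ K : Set (Eu n), IsConvexBody K → ξfun K ∈ interior K ∧
      ∀ η ∈ interior K, PhiE μ φ K η ≤ PhiE μ φ K (ξfun K))
    (c t₀ : ℝ) (hc : 0 < c) (ht₀ : 0 < t₀)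
    (Kt : ℝ → Set (Eu n)) (hKt : ∀ t ∈ Set.Ico 0 t₀, IsConvexBody (Kt t))
    (hlip : ∀ t ∈ Set.Ico 0 t₀, ∀ u ∈ sphere (0 : Eu n) 1,
      |suppFn (Kt t) u - suppFn (Kt 0) u| ≤ c * t)
    (hae : ∀ᵐ u ∂((μH[(n:ℝ) - 1]).restrict (sphere (0 : Eu n) 1)),
      ∃ l : ℝ, Filter.Tendsto (fun t => (suppFn (Kt t) u - suppFn (Kt 0) u) / t)
        (nhdsWithin 0 (Set.Ioi 0)) (nhds l)) :
    ∃ L : Eu n, Filter.Tendsto (fun t : ℝ => t⁻¹ • (ξfun (Kt t) - ξfun (Kt 0)))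
      (nhdsWithin 0 (Set.Ioi 0)) (nhds L) := by
  obtain _ | m := n
  · exact ⟨0, tendsto_const_nhds.congr fun t => Subsingleton.elim _ _⟩
  have hdim : ((m + 1 : ℕ) : ℝ) - 1 = m := by push_cast; ring
  rw [hdim] at hμ hae
  have hfin : IsFiniteMeasure μ :=
    hμ ▸ isFiniteMeasure_sphere_withDensity fun u hu => (hf u hu).2.le
  have hnd : ∀ v : Eu (m + 1), (∀ᵐ u ∂μ, ⟪u, v⟫ = 0) → v = 0 := by
    rw [hμ]
    exact fun v => eq_zero_of_ae_inner_eq_zero_sphere_withDensity hτ.1 fun u hu => (hf u hu).1.le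
  have hac : μ ≪ (μH[(m : ℝ)]).restrict (sphere (0 : Eu (m + 1)) 1) :=
    hμ ▸ withDensity_absolutelyContinuous _ _
  have hS : ∀ᵐ u ∂μ, u ∈ sphere (0 : Eu (m + 1)) 1 :=
    hac.ae_le (ae_restrict_mem isClosed_sphere.measurableSet)
  obtain ⟨-, -, hφd, hφc, -, -, -⟩ := hφ
  have hφ' : ContinuousOn (deriv φ) (Ioi 0) := fun t ht =>
    (hφd t ht).2.1.continuousAt.continuousWithinAt
  have hcont : ∀ t ∈ Ico 0 t₀, Continuous (suppFn (Kt t)) := fun t ht =>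
    continuous_suppFn (hKt t ht).2.1
  have h0I : (0 : ℝ) ∈ Ico 0 t₀ := ⟨le_rfl, ht₀⟩
  have hinner : ∀ t ∈ Ico 0 t₀, ∃ δ > 0, ∀ u ∈ sphere (0 : Eu (m + 1)) 1,
      δ ≤ suppFn (Kt t) u - ⟪u, ξfun (Kt t)⟫ := fun t ht =>
    suppFn_sub_inner_pos (hKt t ht).2.1 (hξfun _ (hKt t ht)).1
  obtain ⟨δ, hδ, hle⟩ := hinner 0 h0I
  obtain ⟨M, hM⟩ := (isCompact_sphere (0 : Eu (m + 1)) 1).bddAbove_image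
    (f := fun u => suppFn (Kt 0) u - ⟪u, ξfun (Kt 0)⟫)
    ((hcont 0 h0I).sub (by fun_prop)).continuousOn
  refine tendsto_slope_critical_point (h := fun t => suppFn (Kt t)) (ξ := fun t => ξfun (Kt t))
    hS hnd (measurable_deriv φ) (fun t ht => (hφd t ht).2.1) (fun t ht => (hφd t ht).2.2) hφc hc
    ht₀ hδ hcont ?_ hle (fun u hu => hM (mem_image_of_mem _ hu)) ?_ hlip (hac.ae_le hae)
  · intro t ht u hu
    obtain ⟨r, hr, hr'⟩ := hinner t ht
    exact hr.trans_le (hr' u hu)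
  · intro t ht
    obtain ⟨r, hr, hr'⟩ := hinner t ht
    obtain ⟨hmem, hmax⟩ := hξfun _ (hKt t ht)
    refine integral_deriv_comp_smul_eq_zero hS (fun t ht => (hφd t ht).1) hφ' (hcont t ht) hr hr' ?_
    filter_upwards [isOpen_interior.mem_nhds hmem] with η hη
    exact hmax η hη

end
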